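/- Let G be a finite simple graph with mad(G) < 3 and ch_3^d(G) > 8 such that every proper subgraph H of G (obtained from G by deleting at least one vertex or at least one edge) satisfies ch_3^d(H) ≤ 8. Then no vertex of G of degree at most 3 has a neighbor of degree 2. -/

import Mathlib

open SimpleGraph

/-- `φ` is a proper coloring of `G` that is 3-dynamic: every vertex `v` sees at least
`min 3 (deg v)` distinct colors on its neighborhood. -/
def IsDyn3Coloring {V : Type*} (G : SimpleGraph V) (φ : V → ℕ) : Prop :=
  (∀ u v, G.Adj u v → φ u ≠ φ v) ∧
  ∀ v, min 3 (G.neighborSet v).ncard ≤ (φ '' G.neighborSet v).ncard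

/-- `G` is 3-dynamically colorable from the list assignment `L`. -/
def Dyn3ListColorable {V : Type*} (G : SimpleGraph V) (L : V → Finset ℕ) : Prop :=
  ∃ φ : V → ℕ, IsDyn3Coloring G φ ∧ ∀ v, φ v ∈ L v

/-- `ch_3^d(G) ≤ k` : `G` is 3-dynamically `L`-colorable for every list assignment `L`
with `|L v| ≥ k` for all `v`. -/
def Ch3dLE {V : Type*} (G : SimpleGraph V) (k : ℕ) : Prop :=
  ∀ L : V → Finset ℕ, (∀ v, k ≤ (L v).card) → Dyn3ListColorable G L

/-- `mad(G) < c` : every nonempty subgraph has average degree `< c`. -/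
def MadLT {V : Type*} (G : SimpleGraph V) (c : ℚ) : Prop :=
  ∀ H : G.Subgraph, H.verts.Nonempty →
    (2 * H.edgeSet.ncard : ℚ) / (H.verts.ncard : ℚ) < c

/-- `mad(G) ≤ c` : every nonempty subgraph has average degree `≤ c`. -/
def MadLE {V : Type*} (G : SimpleGraph V) (c : ℚ) : Prop :=
  ∀ H : G.Subgraph, H.verts.Nonempty →
    (2 * H.edgeSet.ncard : ℚ) / (H.verts.ncard : ℚ) ≤ c

/-- Every proper subgraph of `G` (deleting at least one vertex or edge) has
`ch_3^d ≤ k`. -/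
def ProperSubgraphsCh3dLE {V : Type*} (G : SimpleGraph V) (k : ℕ) : Prop :=
  ∀ H : G.Subgraph, H ≠ ⊤ → Ch3dLE H.coe k

/-- `x ∈ W_i(G)` : `x` has degree 3 and exactly `i` neighbors of degree 2. -/
def Wmem {V : Type*} (G : SimpleGraph V) (i : ℕ) (x : V) : Prop :=
  (G.neighborSet x).ncard = 3 ∧
    {y | G.Adj x y ∧ (G.neighborSet y).ncard = 2}.ncard = i

/-- `y` is a weak neighbor of `x` : they are distinct and have a common neighbor of
degree 2. -/
def WeakAdj {V : Type*} (G : SimpleGraph V) (x y : V) : Prop :=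
  x ≠ y ∧ ∃ w, G.Adj x w ∧ G.Adj y w ∧ (G.neighborSet w).ncard = 2


lemma aux_avoid (T : Set ℕ) (hT : T.Finite) :
    ∃ B : Finset ℕ, B.card ≤ 2 ∧ ∀ c ∉ B, min 3 (T.ncard + 1) ≤ (insert c T).ncard := by
  classical
  by_cases h : 3 ≤ T.ncard
  · refine ⟨∅, by simp, fun c _ => ?_⟩
    have := Set.ncard_le_ncard (Set.subset_insert c T) (hT.insert c)
    omega
  · refine ⟨hT.toFinset, ?_, fun c hc => ?_⟩
    · rw [← Set.ncard_eq_toFinset_card T hT]; omega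
    · rw [Set.ncard_insert_of_notMem (by simpa using hc) hT]; omega

lemma aux_pick (A F : Finset ℕ) (hA : 8 ≤ A.card) (hF : F.card ≤ 7) : ∃ c ∈ A, c ∉ F := by
  by_contra h
  push Not at h
  have := Finset.card_le_card (show A ⊆ F from h)
  omega

lemma aux_img_notMem {V : Type*} [DecidableEq V] (φ : V → ℕ) (v : V) (c : ℕ) (N : Set V)
    (h : v ∉ N) : (Function.update φ v c) '' N = φ '' N := by
  apply Set.image_congr
  intro a ha
  rw [Function.update_of_ne]
  rintro rfl
  exact h ha

lemma aux_img_mem {V : Type*} [DecidableEq V] (φ : V → ℕ) (v : V) (c : ℕ) (N : Set V)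
    (h : v ∈ N) : (Function.update φ v c) '' N = insert c (φ '' (N \ {v})) := by
  conv_lhs => rw [← Set.insert_sdiff_self_of_mem h]
  rw [Set.image_insert_eq, Function.update_self, aux_img_notMem _ _ _ _ (by simp)]

lemma aux_recolor {V : Type*} [Fintype V] (K : SimpleGraph V) (L : V → Finset ℕ)
    (hL : ∀ v, 8 ≤ (L v).card) (φ : V → ℕ) (hφ : IsDyn3Coloring K φ) (hφL : ∀ v, φ v ∈ L v)
    (x z : V) (hxz : x ≠ z) (hx : (K.neighborSet x).ncard ≤ 2) :
    ∃ ψ : V → ℕ, IsDyn3Coloring K ψ ∧ (∀ v, ψ v ∈ L v) ∧ ψ x ≠ ψ z := by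
  classical
  choose B hB2 hB using fun u : V =>
    aux_avoid (φ '' (K.neighborSet u \ {x})) (Set.toFinite _)
  have hcard : (insert (φ z) ((K.neighborSet x).toFinset.biUnion
      fun u => insert (φ u) (B u))).card ≤ 7 := by
    refine (Finset.card_insert_le _ _).trans ?_
    have h1 := Finset.card_biUnion_le_card_mul (K.neighborSet x).toFinset
      (fun u => insert (φ u) (B u)) 3 (fun u _ => by
        refine (Finset.card_insert_le _ _).trans ?_
        have := hB2 u
        omega)
    rw [Set.ncard_eq_toFinset_card'] at hx
    omega
  obtain ⟨c, hcL, hc⟩ := aux_pick (L x) _ (hL x) hcard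
  simp only [Finset.mem_insert, Finset.mem_biUnion, not_or, not_exists, not_and,
    Set.mem_toFinset, mem_neighborSet] at hc
  obtain ⟨hcz, hc⟩ := hc
  refine ⟨Function.update φ x c, ⟨?_, ?_⟩, ?_, ?_⟩
  · intro u v huv
    by_cases hu : u = x
    · subst hu
      rw [Function.update_self, Function.update_of_ne huv.ne']
      exact (hc v huv).1
    · by_cases hv : v = x
      · subst hv
        rw [Function.update_self, Function.update_of_ne hu]
        exact Ne.symm (hc u huv.symm).1
      · rw [Function.update_of_ne hu, Function.update_of_ne hv]
        exact hφ.1 u v huv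
  · intro w
    have h0 := hφ.2 w
    by_cases hw : x ∈ K.neighborSet w
    · rw [aux_img_mem _ _ _ _ hw]
      have h1 := hB w c (hc w (SimpleGraph.Adj.symm hw)).2
      have h2 : φ '' K.neighborSet w = insert (φ x) (φ '' (K.neighborSet w \ {x})) := by
        rw [← Set.image_insert_eq, Set.insert_sdiff_self_of_mem hw]
      rw [h2] at h0
      have h3 := Set.ncard_insert_le (φ x) (φ '' (K.neighborSet w \ {x}))
      omega
    · rw [aux_img_notMem _ _ _ _ hw]; exact h0
  · intro v
    by_cases hv : v = x
    · subst hv; rwa [Function.update_self]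
    · rw [Function.update_of_ne hv]; exact hφL v
  · rw [Function.update_self, Function.update_of_ne hxz.symm]; exact hcz

/-- delete all edges at `y` -/
def auxSub {V : Type*} (G : SimpleGraph V) (y : V) : G.Subgraph where
  verts := Set.univ
  Adj a b := G.Adj a b ∧ a ≠ y ∧ b ≠ y
  adj_sub h := h.1
  edge_vert _ := Set.mem_univ _
  symm := ⟨fun _ _ h => ⟨h.1.symm, h.2.2, h.2.1⟩⟩

lemma aux_transfer {V : Type*} (G : SimpleGraph V) (y : V)
    (h : Ch3dLE (auxSub G y).coe 8) : Ch3dLE (auxSub G y).spanningCoe 8 := by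
  intro L hL
  obtain ⟨φ, ⟨h1, h2⟩, h3⟩ := h (fun v => L v.1) (fun v => hL v.1)
  refine ⟨fun v => φ ⟨v, Set.mem_univ v⟩, ⟨?_, ?_⟩, fun v => h3 ⟨v, Set.mem_univ v⟩⟩
  · intro u v huv
    exact h1 ⟨u, Set.mem_univ u⟩ ⟨v, Set.mem_univ v⟩ huv
  · intro v
    have := h2 ⟨v, Set.mem_univ v⟩
    have e1 : (auxSub G y).spanningCoe.neighborSet v =
        Subtype.val '' ((auxSub G y).coe.neighborSet ⟨v, Set.mem_univ v⟩) := by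
      ext w
      constructor
      · intro hw
        exact ⟨⟨w, Set.mem_univ w⟩, hw, rfl⟩
      · rintro ⟨w, hw, rfl⟩
        exact hw
    rw [e1, Set.ncard_image_of_injective _ Subtype.val_injective, Set.image_image]
    exact this

theorem min_counterexample8_low_vertex_no_two_neighbor {V : Type*} [Fintype V]
    (G : SimpleGraph V) (hmad : MadLT G 3) (hG : ¬ Ch3dLE G 8)
    (hmin : ProperSubgraphsCh3dLE G 8) :
    ∀ x y : V, (G.neighborSet x).ncard ≤ 3 → G.Adj x y →
      (G.neighborSet y).ncard ≠ 2 := by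
  classical
  intro x y hx hxy hy
  apply hG
  intro L hL
  obtain ⟨z, hxz, hN⟩ : ∃ z, x ≠ z ∧ G.neighborSet y = {x, z} := by
    obtain ⟨p, q, hpq, hN⟩ := Set.ncard_eq_two.1 hy
    have hm : x ∈ G.neighborSet y := hxy.symm
    rw [hN] at hm
    rcases hm with rfl | hm
    · exact ⟨q, hpq, hN⟩
    · have hm : x = q := hm
      subst hm
      exact ⟨p, hpq.symm, by rw [hN, Set.pair_comm]⟩
  have hyz : G.Adj y z := by
    have : z ∈ G.neighborSet y := by rw [hN]; simp
    exact this
  have hne : auxSub G y ≠ ⊤ := by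
    intro h
    have : (auxSub G y).Adj x y := by rw [h]; exact hxy
    exact this.2.2 rfl
  obtain ⟨K, hK⟩ : ∃ K, K = (auxSub G y).spanningCoe := ⟨_, rfl⟩
  have hKadj : ∀ a b, K.Adj a b ↔ G.Adj a b ∧ a ≠ y ∧ b ≠ y := by
    intro a b; rw [hK]; rfl
  have hKN : ∀ w, w ≠ y → K.neighborSet w = G.neighborSet w \ {y} := by
    intro w hw
    ext b
    simp only [mem_neighborSet, hKadj, Set.mem_diff, Set.mem_singleton_iff]
    tauto
  have hKcard : ∀ w, G.Adj w y → (G.neighborSet w).ncard = (K.neighborSet w).ncard + 1 := by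
    intro w hw
    rw [hKN w hw.ne]
    exact (Set.ncard_diff_singleton_add_one hw (Set.toFinite _)).symm
  have hx2 : (K.neighborSet x).ncard ≤ 2 := by
    have := hKcard x hxy
    omega
  obtain ⟨φ, hφ, hφL⟩ : Dyn3ListColorable K L := by
    rw [hK]; exact aux_transfer G y (hmin _ hne) L hL
  obtain ⟨ψ, hψ, hψL, hψxz⟩ := aux_recolor K L hL φ hφ hφL x z hxz hx2
  obtain ⟨B, hB2, hB⟩ := aux_avoid (ψ '' K.neighborSet z) (Set.toFinite _)
  have hcard : (({ψ x, ψ z} : Finset ℕ) ∪ ((K.neighborSet x).toFinset.image ψ ∪ B)).card ≤ 7 := by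
    have h1 := Finset.card_union_le ({ψ x, ψ z} : Finset ℕ) ((K.neighborSet x).toFinset.image ψ ∪ B)
    have h2 := Finset.card_union_le ((K.neighborSet x).toFinset.image ψ) B
    have h3 := Finset.card_image_le (s := (K.neighborSet x).toFinset) (f := ψ)
    have h4 := Finset.card_le_two (a := ψ x) (b := ψ z)
    rw [Set.ncard_eq_toFinset_card'] at hx2
    omega
  obtain ⟨d, hdL, hd⟩ := aux_pick (L y) _ (hL y) hcard
  simp only [Finset.mem_union, Finset.mem_insert, Finset.mem_singleton, not_or] at hd
  obtain ⟨⟨hdx, hdz⟩, hdN, hdB⟩ := hd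
  have hdy : ∀ b, G.Adj y b → d ≠ ψ b := by
    intro b hb
    have hb : b ∈ G.neighborSet y := hb
    rw [hN] at hb
    rcases hb with rfl | hb
    · exact hdx
    · have hb : b = z := hb
      rw [hb]; exact hdz
  refine ⟨Function.update ψ y d, ⟨?_, ?_⟩, ?_⟩
  · intro u v huv
    by_cases hu : u = y
    · subst hu
      rw [Function.update_self, Function.update_of_ne huv.ne']
      exact hdy v huv
    · by_cases hv : v = y
      · subst hv
        rw [Function.update_self, Function.update_of_ne hu]
        exact (hdy u huv.symm).symm
      · rw [Function.update_of_ne hu, Function.update_of_ne hv]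
        exact hψ.1 u v ((hKadj u v).2 ⟨huv, hu, hv⟩)
  · intro w
    by_cases hwy : w = y
    · rw [hwy, aux_img_notMem _ _ _ _ (by simp), hy, hN, Set.image_pair,
        Set.ncard_pair hψxz]
      omega
    have h0 := hψ.2 w
    by_cases hw : y ∈ G.neighborSet w
    · rw [aux_img_mem _ _ _ _ hw, ← hKN w hwy, hKcard w hw]
      have hm : w ∈ G.neighborSet y := SimpleGraph.Adj.symm hw
      rw [hN] at hm
      rcases hm with rfl | hm
      · rw [Set.ncard_insert_of_notMem (by simpa using hdN) (Set.toFinite _)]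
        omega
      · have hm : w = z := hm
        subst hm
        have := hB d hdB
        omega
    · rw [aux_img_notMem _ _ _ _ hw]
      rwa [hKN w hwy, Set.diff_singleton_eq_self hw] at h0
  · intro v
    by_cases hv : v = y
    · subst hv; rwa [Function.update_self]
    · rw [Function.update_of_ne hv]; exact hψL v
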